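/- Let N_x, N_y, N_z > M ≥ 0 be integers and K : ℤ³ → ℝ with K(m, n, l) = 0 whenever |m| > M or |n| > M or |l| > M. Define G : ZMod (2N_x) × ZMod (2N_y) × ZMod (2N_z) → ℝ by G(a, b, c) = K(m, n, l) where m, n, l are the representatives of a, b, c in [−N_x, N_x−1], [−N_y, N_y−1], [−N_z, N_z−1] respectively. Let u : {0,…,N_x−1} × {0,…,N_y−1} × {0,…,N_z−1} → ℝ and let U be its zero extension to ZMod (2N_x) × ZMod (2N_y) × ZMod (2N_z). Then for every (i, j, k) with 0 ≤ i < N_x, 0 ≤ j < N_y, 0 ≤ k < N_z, Σ_{(a,b,c)} G(i − a, j − b, k − c) · U(a, b, c) = Σ_{i'=0}^{N_x−1} Σ_{j'=0}^{N_y−1} Σ_{k'=0}^{N_z−1} K(i − i', j − j', k − k') · u(i', j', k'). -/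

import Mathlib

/-- Exactness of the 3D circulant embedding used by the FFT-based fast
tensor-tensor multiplication: the product of the TBTBT matrix generated by a
kernel `K` supported in the band `|m| ≤ M, |n| ≤ M, |l| ≤ M` with the array
`u` is recovered exactly from the size-`(2N_x) × (2N_y) × (2N_z)` cyclic
convolution of the zero-padded arrays `G` and `U`. -/
theorem circulant_embedding_exact_3d
    (Nx Ny Nz M : ℕ) (hMNx : M < Nx) (hMNy : M < Ny) (hMNz : M < Nz)
    (K : ℤ → ℤ → ℤ → ℝ)
    (hK : ∀ m n l : ℤ, ((M : ℤ) < |m| ∨ (M : ℤ) < |n| ∨ (M : ℤ) < |l|) → K m n l = 0)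
    (G : ZMod (2 * Nx) → ZMod (2 * Ny) → ZMod (2 * Nz) → ℝ)
    (hG : ∀ m n l : ℤ, -(Nx : ℤ) ≤ m → m < (Nx : ℤ) → -(Ny : ℤ) ≤ n → n < (Ny : ℤ) →
      -(Nz : ℤ) ≤ l → l < (Nz : ℤ) →
      G ((m : ℤ) : ZMod (2 * Nx)) ((n : ℤ) : ZMod (2 * Ny)) ((l : ℤ) : ZMod (2 * Nz))
        = K m n l)
    (u : ℤ → ℤ → ℤ → ℝ)
    (U : ZMod (2 * Nx) → ZMod (2 * Ny) → ZMod (2 * Nz) → ℝ)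
    (hU : ∀ a b c : ℤ, 0 ≤ a → a < (Nx : ℤ) → 0 ≤ b → b < (Ny : ℤ) →
      0 ≤ c → c < (Nz : ℤ) →
      U ((a : ℤ) : ZMod (2 * Nx)) ((b : ℤ) : ZMod (2 * Ny)) ((c : ℤ) : ZMod (2 * Nz))
        = u a b c)
    (hU0 : ∀ a b c : ℤ, 0 ≤ a → a < 2 * (Nx : ℤ) → 0 ≤ b → b < 2 * (Ny : ℤ) →
      0 ≤ c → c < 2 * (Nz : ℤ) →
      ((Nx : ℤ) ≤ a ∨ (Ny : ℤ) ≤ b ∨ (Nz : ℤ) ≤ c) →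
      U ((a : ℤ) : ZMod (2 * Nx)) ((b : ℤ) : ZMod (2 * Ny)) ((c : ℤ) : ZMod (2 * Nz))
        = 0)
    (i j k : ℤ) (hi0 : 0 ≤ i) (hiN : i < (Nx : ℤ)) (hj0 : 0 ≤ j) (hjN : j < (Ny : ℤ))
    (hk0 : 0 ≤ k) (hkN : k < (Nz : ℤ)) :
    ∑ a ∈ Finset.range (2 * Nx), ∑ b ∈ Finset.range (2 * Ny), ∑ c ∈ Finset.range (2 * Nz),
        G (((i - (a : ℤ)) : ℤ) : ZMod (2 * Nx)) (((j - (b : ℤ)) : ℤ) : ZMod (2 * Ny))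
            (((k - (c : ℤ)) : ℤ) : ZMod (2 * Nz)) *
          U (((a : ℕ) : ℤ) : ZMod (2 * Nx)) (((b : ℕ) : ℤ) : ZMod (2 * Ny))
            (((c : ℕ) : ℤ) : ZMod (2 * Nz))
      = ∑ i' ∈ Finset.range Nx, ∑ j' ∈ Finset.range Ny, ∑ k' ∈ Finset.range Nz,
          K (i - (i' : ℤ)) (j - (j' : ℤ)) (k - (k' : ℤ)) * u (i' : ℤ) (j' : ℤ) (k' : ℤ) := by
  have hpad : ∀ a < 2 * Nx, ∀ b < 2 * Ny, ∀ c < 2 * Nz, (Nx ≤ a ∨ Ny ≤ b ∨ Nz ≤ c) →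
      U (((a : ℕ) : ℤ) : ZMod (2 * Nx)) (((b : ℕ) : ℤ) : ZMod (2 * Ny))
        (((c : ℕ) : ℤ) : ZMod (2 * Nz)) = 0 := fun a ha b hb c hc h =>
    hU0 a b c (by lia) (by lia) (by lia) (by lia) (by lia) (by lia) (by lia)
  have hsub : ∀ n : ℕ, Finset.range n ⊆ Finset.range (2 * n) := fun n =>
    Finset.range_subset_range.2 (by lia)
  symm
  refine Finset.sum_subset_zero_on_sdiff (hsub Nx) (fun a ha => ?_) (fun a ha => ?_)
  · simp only [Finset.mem_sdiff, Finset.mem_range, not_lt] at ha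
    refine Finset.sum_eq_zero fun b hb => Finset.sum_eq_zero fun c hc => ?_
    rw [hpad a ha.1 b (Finset.mem_range.1 hb) c (Finset.mem_range.1 hc) (.inl ha.2), mul_zero]
  rw [Finset.mem_range] at ha
  refine Finset.sum_subset_zero_on_sdiff (hsub Ny) (fun b hb => ?_) (fun b hb => ?_)
  · simp only [Finset.mem_sdiff, Finset.mem_range, not_lt] at hb
    refine Finset.sum_eq_zero fun c hc => ?_
    rw [hpad a (by lia) b hb.1 c (Finset.mem_range.1 hc) (.inr (.inl hb.2)), mul_zero]
  rw [Finset.mem_range] at hb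
  refine Finset.sum_subset_zero_on_sdiff (hsub Nz) (fun c hc => ?_) (fun c hc => ?_)
  · simp only [Finset.mem_sdiff, Finset.mem_range, not_lt] at hc
    rw [hpad a (by lia) b (by lia) c hc.1 (.inr (.inr hc.2)), mul_zero]
  rw [Finset.mem_range] at hc
  rw [hU a b c (by lia) (by lia) (by lia) (by lia) (by lia) (by lia),
    hG _ _ _ (by lia) (by lia) (by lia) (by lia) (by lia) (by lia)]
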